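/- Asymptotic welfare of the Proportional rule for a good under i.i.d. utilities (Lemma 3): let ν be a Borel probability measure on [0,∞) with ∫x dν = 1 and ∫x^β dν < ∞ for some β > 2, and let X₁, X₂, … be i.i.d. random variables with distribution ν. Then n·E[X₁²/(X₁ + … + Xₙ)] converges to ∫x² dν as n → ∞ (with the convention that the integrand is 0 when X₁ + … + Xₙ = 0). Consequently, the ratio of the optimal utilitarian welfare to the welfare of the Proportional rule satisfies π(φ^pro, P_n(ν)) = (E[max_{i≤n} X_i] / ∫x² dν)·(1 + o(1)) as n → ∞. -/

import Mathlib

open MeasureTheory Filter Topology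

noncomputable section

open ProbabilityTheory

lemma exp_neg_le_quadratic {y : ℝ} (hy : 0 ≤ y) : Real.exp (-y) ≤ 1 - y + y ^ 2 / 2 := by
  have h := Real.quadratic_le_exp_of_nonneg hy
  have hq : 0 < 1 + y + y ^ 2 / 2 := by positivity
  rw [Real.exp_neg]
  calc (Real.exp y)⁻¹ ≤ (1 + y + y ^ 2 / 2)⁻¹ := inv_anti₀ hq h
    _ ≤ 1 - y + y ^ 2 / 2 := by
      rw [inv_le_iff_one_le_mul₀ hq]
      nlinarith [sq_nonneg (y ^ 2)]

lemma integrable_sq_of_integrable_rpow {ν : Measure ℝ} [IsFiniteMeasure ν] {β : ℝ} (hβ : 2 ≤ β)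
    (hmom : Integrable (fun x : ℝ => |x| ^ β) ν) : Integrable (fun x : ℝ => x ^ 2) ν := by
  refine ((integrable_const (1 : ℝ)).add hmom).mono' (by fun_prop) (ae_of_all _ fun x => ?_)
  rw [Real.norm_eq_abs, abs_pow, Pi.add_apply]
  rcases le_total |x| 1 with h | h
  · have := pow_le_one₀ (abs_nonneg x) h (n := 2)
    have := Real.rpow_nonneg (abs_nonneg x) β
    linarith
  · have := Real.rpow_le_rpow_of_exponent_le h hβ
    rw [Real.rpow_two] at this
    linarith

lemma integrable_exp_mul_of_nonpos {Ω : Type*} {mΩ : MeasurableSpace Ω} {P : Measure Ω}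
    [IsFiniteMeasure P] {Y : Ω → ℝ} (hY : Measurable Y) (hpos : ∀ᵐ ω ∂P, 0 ≤ Y ω) {t : ℝ}
    (ht : t ≤ 0) : Integrable (fun ω => Real.exp (t * Y ω)) P := by
  refine (integrable_const (1 : ℝ)).mono' (by fun_prop) ?_
  filter_upwards [hpos] with ω hω
  rw [Real.norm_eq_abs, Real.abs_exp, Real.exp_le_one_iff]
  exact mul_nonpos_of_nonpos_of_nonneg ht hω

lemma one_le_integral_sq {ν : Measure ℝ} [IsProbabilityMeasure ν]
    (hint : Integrable (fun x : ℝ => x) ν) (hmean : ∫ x, x ∂ν = 1)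
    (hsq : Integrable (fun x : ℝ => x ^ 2) ν) : 1 ≤ ∫ x, x ^ 2 ∂ν := by
  have h : ∫ x, (2 * x - 1) ∂ν ≤ ∫ x, x ^ 2 ∂ν :=
    integral_mono ((hint.const_mul 2).sub (integrable_const 1)) hsq fun x => by
      nlinarith [sq_nonneg (x - 1)]
  rw [integral_sub (hint.const_mul 2) (integrable_const 1), integral_const_mul, hmean] at h
  simp only [integral_const, probReal_univ, smul_eq_mul] at h
  linarith

/-- A nonnegative law of mean one with finite second moment has a Chernoff rate below one
at the level `1 / 2`. -/
lemma exists_exp_mul_mgf_lt_one {ν : Measure ℝ} [IsProbabilityMeasure ν]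
    (hpos : ∀ᵐ x ∂ν, 0 ≤ x) (hint : Integrable (fun x : ℝ => x) ν) (hmean : ∫ x, x ∂ν = 1)
    (hsq : Integrable (fun x : ℝ => x ^ 2) ν) :
    ∃ t ≤ 0, Real.exp (-t / 2) * mgf id ν t < 1 := by
  set m := ∫ x, x ^ 2 ∂ν with hm
  have hm1 : 1 ≤ m := one_le_integral_sq hint hmean hsq
  set s : ℝ := 1 / (2 * m) with hs
  have hs0 : 0 < s := by positivity
  have hsm : s * m = 1 / 2 := by rw [hs]; field_simp
  refine ⟨-s, by linarith, ?_⟩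
  have i1 : Integrable (fun x : ℝ => 1 - s * x) ν := (integrable_const 1).sub (hint.const_mul s)
  have i2 : Integrable (fun x : ℝ => s ^ 2 / 2 * x ^ 2) ν := hsq.const_mul _
  have hmgf : mgf id ν (-s) ≤ 1 - s + s ^ 2 / 2 * m := by
    calc mgf id ν (-s) ≤ ∫ x, ((1 - s * x) + s ^ 2 / 2 * x ^ 2) ∂ν := by
          refine integral_mono_ae (integrable_exp_mul_of_nonpos measurable_id hpos (by linarith))
            (i1.add i2) ?_
          filter_upwards [hpos] with x hx
          have := exp_neg_le_quadratic (mul_nonneg hs0.le hx)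
          simp only [id, neg_mul]
          linarith
      _ = 1 - s + s ^ 2 / 2 * m := by
          rw [integral_add i1 i2, integral_sub (integrable_const 1) (hint.const_mul s),
            integral_const_mul, integral_const_mul, hmean]
          simp [hm]
  have hb : 1 - s + s ^ 2 / 2 * m ≤ Real.exp (-s + s / 4) := by
    have := Real.add_one_le_exp (-s + s / 4)
    nlinarith
  calc Real.exp (- -s / 2) * mgf id ν (-s)
      ≤ Real.exp (s / 2) * Real.exp (-s + s / 4) := by
        rw [neg_neg]
        gcongr
        exact hmgf.trans hb
    _ = Real.exp (-(s / 4)) := by rw [← Real.exp_add]; ring_nf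
    _ < 1 := by rw [Real.exp_lt_one_iff]; linarith

section IID

variable {Ω : Type*} {mΩ : MeasurableSpace Ω} {P : Measure Ω} [IsProbabilityMeasure P]
  {ν : Measure ℝ} {X : ℕ → Ω → ℝ}

lemma measureReal_sum_le_half_le_pow (hX : ∀ i, Measurable (X i)) (hlaw : ∀ i, HasLaw (X i) ν P)
    (hindep : iIndepFun X P) (hpos : ∀ᵐ ω ∂P, ∀ i, 0 ≤ X i ω) {t : ℝ} (ht : t ≤ 0) (n : ℕ) :
    P.real {ω | ∑ i ∈ Finset.range n, X i ω ≤ n / 2} ≤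
      (Real.exp (-t / 2) * mgf id ν t) ^ n := by
  have hmgf (i : ℕ) : mgf (X i) P t = mgf id ν t := by
    rw [← mgf_id_map (hX i).aemeasurable, (hlaw i).map_eq]
  have hexp : Integrable (fun ω => Real.exp (t * (∑ i ∈ Finset.range n, X i) ω)) P := by
    refine integrable_exp_mul_of_nonpos (by fun_prop) ?_ ht
    filter_upwards [hpos] with ω hω
    rw [Finset.sum_apply]
    exact Finset.sum_nonneg fun i _ => hω i
  have h := measure_le_le_exp_mul_mgf ((n : ℝ) / 2) ht hexp
  simp only [Finset.sum_apply] at h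
  rw [hindep.mgf_sum hX, Finset.prod_congr rfl fun i _ => hmgf i, Finset.prod_const,
    Finset.card_range, show -t * ((n : ℝ) / 2) = n * (-t / 2) by ring, Real.exp_nat_mul,
    ← mul_pow] at h
  exact h

/-- The `n`-agent welfare of the proportional rule converges to the second moment. -/
lemma tendsto_integral_sq_div_sum (hX : ∀ i, Measurable (X i)) (hlaw : ∀ i, HasLaw (X i) ν P)
    (hindep : iIndepFun X P) (hpos : ∀ᵐ x ∂ν, 0 ≤ x)
    (hint : Integrable (fun x : ℝ => x) ν) (hmean : ∫ x, x ∂ν = 1)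
    (hsq : Integrable (fun x : ℝ => x ^ 2) ν) :
    Tendsto (fun n : ℕ => ∫ ω, ((n : ℝ) + 1) *
      (X 0 ω ^ 2 / (X 0 ω + ∑ i ∈ Finset.range n, X (i + 1) ω)) ∂P)
      atTop (𝓝 (∫ x, x ^ 2 ∂ν)) := by
  have : IsProbabilityMeasure ν := (hlaw 0).isProbabilityMeasure_iff.1 inferInstance
  have hposX : ∀ᵐ ω ∂P, ∀ i, 0 ≤ X i ω :=
    ae_all_iff.2 fun i => ((hlaw i).ae_iff (by fun_prop)).2 hpos
  have hposY : ∀ᵐ ω ∂P, ∀ i, 0 ≤ X (i + 1) ω := hposX.mono fun ω h i => h _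
  have hindepY : iIndepFun (fun i => X (i + 1)) P := hindep.precomp (add_left_injective 1)
  have hintX (i : ℕ) : Integrable (X i) P :=
    ((hlaw i).measurePreserving (hX i)).integrable_comp_of_integrable hint
  have hintX2 : Integrable (fun ω => X 0 ω ^ 2) P :=
    ((hlaw 0).measurePreserving (hX 0)).integrable_comp_of_integrable hsq
  have hmeanX (i : ℕ) : ∫ ω, X i ω ∂P = 1 := (hlaw i).integral_eq.trans hmean
  have hsqX : ∫ ω, X 0 ω ^ 2 ∂P = ∫ x, x ^ 2 ∂ν :=
    (hlaw 0).integral_comp (f := fun x => x ^ 2) (by fun_prop)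
  set T : ℕ → Ω → ℝ := fun n ω => ∑ i ∈ Finset.range n, X (i + 1) ω with hT
  have hTmeas (n : ℕ) : Measurable (T n) := by fun_prop
  set f : ℕ → Ω → ℝ := fun n ω => ((n : ℝ) + 1) * (X 0 ω ^ 2 / (X 0 ω + T n ω)) with hf
  have hfmeas (n : ℕ) : Measurable (f n) := by fun_prop
  have hTpos : ∀ᵐ ω ∂P, ∀ n, 0 ≤ T n ω :=
    hposY.mono fun ω h n => Finset.sum_nonneg fun i _ => h i
  have hf0 : ∀ᵐ ω ∂P, ∀ n, 0 ≤ f n ω := by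
    filter_upwards [hposX, hTpos] with ω h1 h2 n
    have := h1 0
    have := h2 n
    positivity
  have hfle : ∀ᵐ ω ∂P, ∀ n : ℕ, f n ω ≤ ((n : ℝ) + 1) * X 0 ω := by
    filter_upwards [hposX, hTpos] with ω h1 h2 n
    have h3 := h1 0
    have h4 := h2 n
    refine mul_le_mul_of_nonneg_left (div_le_of_le_mul₀ (by positivity) h3 ?_) (by positivity)
    nlinarith
  have hfint (n : ℕ) : Integrable (f n) P := by
    refine ((hintX 0).const_mul ((n : ℝ) + 1)).mono' (hfmeas n).aestronglyMeasurable ?_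
    filter_upwards [hf0, hfle] with ω h1 h2
    rw [Real.norm_of_nonneg (h1 n)]
    exact h2 n
  set B : ℕ → Set Ω := fun n => {ω | T n ω ≤ n / 2} with hB
  have hBmeas (n : ℕ) : MeasurableSet (B n) := measurableSet_le (hTmeas n) measurable_const
  have hbad : Tendsto (fun n => ∫ ω in B n, f n ω ∂P) atTop (𝓝 0) := by
    obtain ⟨t, ht, hr⟩ := exists_exp_mul_mgf_lt_one hpos hint hmean hsq
    set r := Real.exp (-t / 2) * mgf id ν t
    have hr0 : 0 ≤ r := mul_nonneg (Real.exp_nonneg _) mgf_nonneg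
    have hlim : Tendsto (fun n : ℕ => ((n : ℝ) + 1) * r ^ n) atTop (𝓝 0) := by
      simpa [add_mul] using (tendsto_self_mul_const_pow_of_lt_one hr0 hr).add
        (tendsto_pow_atTop_nhds_zero_of_lt_one hr0 hr)
    refine squeeze_zero (fun n => integral_nonneg_of_ae (ae_restrict_of_ae
      (hf0.mono fun ω h => h n))) (fun n => ?_) hlim
    have hind : ∫ ω in B n, X 0 ω ∂P = P.real (B n) := by
      have hTX : IndepFun (T n) (X 0) P := by
        have h := hindep.indepFun_finsetSum_of_notMem hX
          (s := (Finset.range n).image (· + 1)) (i := 0) (by simp)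
        rw [Finset.sum_image fun a _ b _ h => add_left_injective 1 h] at h
        convert h using 1
        ext ω
        simp [hT]
      have hg : Measurable ((Set.Iic ((n : ℝ) / 2)).indicator (1 : ℝ → ℝ)) :=
        measurable_one.indicator measurableSet_Iic
      have h := (hTX.comp hg measurable_id).integral_fun_mul_eq_mul_integral
        (hg.comp (hTmeas n)).aestronglyMeasurable (hX 0).aestronglyMeasurable
      have e1 : ((Set.Iic ((n : ℝ) / 2)).indicator (1 : ℝ → ℝ)) ∘ T n = (B n).indicator 1 := by
        ext ω
        simp [Set.indicator, hB]
      rw [e1, integral_indicator_one (hBmeas n)] at h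
      simp only [Function.id_comp, hmeanX, mul_one] at h
      rw [← integral_indicator (hBmeas n), ← h]
      refine integral_congr_ae (ae_of_all _ fun ω => ?_)
      by_cases hω : ω ∈ B n <;> simp [hω]
    calc ∫ ω in B n, f n ω ∂P ≤ ∫ ω in B n, ((n : ℝ) + 1) * X 0 ω ∂P :=
          setIntegral_mono_ae (hfint n).integrableOn ((hintX 0).const_mul _).integrableOn
            (hfle.mono fun ω h => h n)
      _ = ((n : ℝ) + 1) * P.real (B n) := by rw [integral_const_mul, hind]
      _ ≤ ((n : ℝ) + 1) * r ^ n := by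
          gcongr
          exact measureReal_sum_le_half_le_pow (fun i => hX (i + 1)) (fun i => hlaw (i + 1))
            hindepY hposY ht n
  have hgood : Tendsto (fun n => ∫ ω in (B n)ᶜ, f n ω ∂P) atTop (𝓝 (∫ ω, X 0 ω ^ 2 ∂P)) := by
    simp_rw [← integral_indicator (hBmeas _).compl]
    refine tendsto_integral_of_dominated_convergence (fun ω => 4 * X 0 ω ^ 2)
      (fun n => ((hfmeas n).indicator (hBmeas n).compl).aestronglyMeasurable)
      (hintX2.const_mul 4) (fun n => ?_) ?_
    · filter_upwards [hposX, hTpos, hf0] with ω h1 h2 h3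
      by_cases hω : ω ∈ B n
      · simp only [Set.mem_compl_iff, hω, not_true_eq_false, not_false_eq_true,
          Set.indicator_of_notMem, norm_zero]
        positivity
      · rw [Set.indicator_of_mem (by exact hω), Real.norm_of_nonneg (h3 n)]
        have hω' : (n : ℝ) / 2 < T n ω := not_le.1 hω
        have hn : (1 : ℝ) ≤ n := by
          rcases Nat.eq_zero_or_pos n with rfl | hn
          · simp [hT] at hω'
          · exact_mod_cast hn
        have h0 := h1 0
        have hden : 0 < X 0 ω + T n ω := by linarith
        rw [hf]
        simp only
        rw [← mul_div_assoc, div_le_iff₀ hden]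
        nlinarith [sq_nonneg (X 0 ω)]
    · have hslln := strong_law_ae_real (fun i => X (i + 1)) (hintX 1)
        (fun i j hij => hindepY.indepFun hij)
        (fun i => (hlaw (i + 1)).identDistrib (hlaw (0 + 1)))
      filter_upwards [hslln, hposX, hTpos] with ω hω h1 h2
      rw [zero_add, hmeanX] at hω
      have hev : ∀ᶠ n : ℕ in atTop, (1 / 2 : ℝ) < T n ω / n :=
        hω.eventually_const_lt (by norm_num)
      have hlim : Tendsto (fun n : ℕ => X 0 ω ^ 2 * (1 + (n : ℝ)⁻¹) /
          (X 0 ω * (n : ℝ)⁻¹ + T n ω / n)) atTop (𝓝 (X 0 ω ^ 2)) := by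
        have hinv := tendsto_inv_atTop_nhds_zero_nat (𝕜 := ℝ)
        have h := ((hinv.const_add 1).const_mul (X 0 ω ^ 2)).div
          ((hinv.const_mul (X 0 ω)).add hω) (by simp)
        simp only [add_zero, mul_one, mul_zero, zero_add, div_one] at h
        exact h
      refine hlim.congr' ?_
      filter_upwards [hev, eventually_gt_atTop 0] with n hn hn0
      have hn0' : (0 : ℝ) < n := by exact_mod_cast hn0
      rw [lt_div_iff₀ hn0'] at hn
      have hω' : ω ∈ (B n)ᶜ := by
        simp only [hB, Set.mem_compl_iff, Set.mem_ofPred_eq, not_le]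
        linarith
      rw [Set.indicator_of_mem hω']
      have hden : X 0 ω + T n ω ≠ 0 := by linarith [h1 0]
      have hden' : X 0 ω * (n : ℝ)⁻¹ + T n ω / n ≠ 0 := by
        rw [← div_eq_mul_inv, ← add_div]
        positivity
      simp only [hf]
      field_simp
  have := hbad.add hgood
  rw [zero_add, hsqX] at this
  exact this.congr fun n => integral_add_compl (hBmeas n) (hfint n)

end IID

lemma one_le_integral_iSup {ν : Measure ℝ} [IsProbabilityMeasure ν]
    (hint : Integrable (fun x : ℝ => x) ν) (hmean : ∫ x, x ∂ν = 1) (n : ℕ) :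
    1 ≤ ∫ x : Fin (n + 1) → ℝ, ⨆ i, x i ∂(Measure.pi fun _ : Fin (n + 1) => ν) := by
  have hmp (i : Fin (n + 1)) := measurePreserving_eval (fun _ : Fin (n + 1) => ν) i
  have hev (i : Fin (n + 1)) : Integrable (fun x : Fin (n + 1) → ℝ => x i)
      (Measure.pi fun _ : Fin (n + 1) => ν) := (hmp i).integrable_comp_of_integrable hint
  have hle (x : Fin (n + 1) → ℝ) (i : Fin (n + 1)) : x i ≤ ⨆ j, x j :=
    le_ciSup (Set.finite_range x).bddAbove i
  have hsup : Integrable (fun x : Fin (n + 1) → ℝ => ⨆ i, x i)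
      (Measure.pi fun _ : Fin (n + 1) => ν) := by
    refine (integrable_finsetSum Finset.univ fun i _ => (hev i).abs).mono'
      (Measurable.iSup fun i => measurable_pi_apply i).aestronglyMeasurable
      (ae_of_all _ fun x => ?_)
    have habs (i : Fin (n + 1)) : |x i| ≤ ∑ j, |x j| :=
      Finset.single_le_sum (f := fun j => |x j|) (fun _ _ => abs_nonneg _) (Finset.mem_univ i)
    exact abs_le.2 ⟨(abs_le.1 (habs 0)).1.trans (hle x 0),
      ciSup_le fun i => (abs_le.1 (habs i)).2⟩
  calc (1 : ℝ) = ∫ x : Fin (n + 1) → ℝ, x 0 ∂(Measure.pi fun _ : Fin (n + 1) => ν) := by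
        rw [← hmean]
        exact ((hmp 0).hasLaw.integral_eq).symm
    _ ≤ _ := integral_mono (hev 0) hsup fun x => hle x 0

/-- Lemma 3 (asymptotic welfare of the Proportional rule for a good under
i.i.d. utilities): let `ν` be a Borel probability measure on `[0,∞)` with mean
`1` and a finite moment of order `β > 2`, and let the `n` agents' utilities be
i.i.d. with law `ν` (the product measure on `Fin n → ℝ`).  Then the expected
welfare of the Proportional rule, `n·E[X₁²/(X₁+…+Xₙ)]`, converges to `∫x² dν`
as `n → ∞` (with the Lean convention that the integrand is `0` when the sum
vanishes); consequently the ratio `π(φ^pro, P_n(ν))` of the optimal utilitarian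
welfare `E[max_i X_i]` to the rule's welfare equals
`(E[max_i X_i]/∫x² dν)·(1 + o(1))`. -/
theorem proportional_rule_asymptotics
    (ν : Measure ℝ) [IsProbabilityMeasure ν]
    (hpos : ∀ᵐ x ∂ν, 0 ≤ x)
    (hint : Integrable (fun x : ℝ => x) ν)
    (hmean : ∫ x, x ∂ν = 1)
    (β : ℝ) (hβ : 2 < β)
    (hmom : Integrable (fun x : ℝ => |x| ^ β) ν) :
    Tendsto
      (fun n : ℕ => ((n : ℝ) + 1) *
        ∫ x : Fin (n + 1) → ℝ, (x 0) ^ 2 / (∑ i, x i)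
          ∂(Measure.pi fun _ : Fin (n + 1) => ν))
      atTop (𝓝 (∫ x, x ^ 2 ∂ν)) ∧
    Tendsto
      (fun n : ℕ =>
        ((∫ x : Fin (n + 1) → ℝ, ⨆ i, x i ∂(Measure.pi fun _ : Fin (n + 1) => ν)) /
            (((n : ℝ) + 1) *
              ∫ x : Fin (n + 1) → ℝ, (x 0) ^ 2 / (∑ i, x i)
                ∂(Measure.pi fun _ : Fin (n + 1) => ν))) /
          ((∫ x : Fin (n + 1) → ℝ, ⨆ i, x i ∂(Measure.pi fun _ : Fin (n + 1) => ν)) /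
            (∫ x, x ^ 2 ∂ν)))
      atTop (𝓝 1) := by
  have hsq := integrable_sq_of_integrable_rpow hβ.le hmom
  have hwelfare : Tendsto
      (fun n : ℕ => ((n : ℝ) + 1) *
        ∫ x : Fin (n + 1) → ℝ, (x 0) ^ 2 / (∑ i, x i)
          ∂(Measure.pi fun _ : Fin (n + 1) => ν))
      atTop (𝓝 (∫ x, x ^ 2 ∂ν)) := by
    obtain ⟨Ω, _, P, X, hX, hlaw, hindep, hP⟩ := exists_iid ℕ ν
    refine (tendsto_integral_sq_div_sum hX hlaw hindep hpos hint hmean hsq).congr fun n => ?_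
    have hpi : HasLaw (fun ω (i : Fin (n + 1)) => X i ω)
        (Measure.pi fun _ : Fin (n + 1) => ν) P :=
      (hindep.precomp Fin.val_injective).hasLaw_pi fun i => hlaw i
    rw [integral_const_mul, ← hpi.integral_comp (f := fun x => x 0 ^ 2 / ∑ i, x i)
      (by fun_prop : Measurable _).aestronglyMeasurable]
    congr 1
    refine integral_congr_ae (ae_of_all _ fun ω => ?_)
    simp [Fin.sum_univ_succ, Finset.sum_range]
  refine ⟨hwelfare, ?_⟩
  have hm : ∫ x, x ^ 2 ∂ν ≠ 0 := by linarith [one_le_integral_sq hint hmean hsq]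
  have hratio := (tendsto_const_nhds (x := ∫ x, x ^ 2 ∂ν)).div hwelfare hm
  rw [div_self hm] at hratio
  refine hratio.congr fun n => ?_
  have hmax := one_le_integral_iSup hint hmean n
  rw [div_div_div_comm, div_self (by linarith), one_div_div, Pi.div_apply]
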